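/- arXiv:1012.5954 — 2 statements merged into one kernel-verified Lean document; each statement's English description precedes it below -/
import Mathlib

section
/- Let k be a field of characteristic zero and G a finite small subgroup of GL_d(k) acting on the polynomial ring S = k[x_1,…,x_d], with invariant subring R = S^G. Then the map φ : S*G → End_R(S) from the skew group algebra to the R-linear endomorphism ring of S, given by φ(s ⊗ g)(t) = s·g(t) for s,t ∈ S and g ∈ G, is an isomorphism of k-algebras (in particular it is bijective). -/
open MvPolynomial Matrix

noncomputable section

variable (k : Type) [Field k] (d : ℕ)

/-- The `k`-algebra endomorphism of `S = k[x_1,…,x_d]` induced by a `d × d` matrix `M`,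
sending the variable `X i` to the linear form `∑ j, M j i • X j`.  This is the action of
`GL_d(k)` on `S` extending the linear action on the degree-one part `V`. -/
def matAct (M : Matrix (Fin d) (Fin d) k) :
    MvPolynomial (Fin d) k →ₐ[k] MvPolynomial (Fin d) k :=
  aeval fun i => ∑ j, M j i • X j

/-- The invariant subalgebra `R = S^G` of a subgroup `G ≤ GL_d(k)`. -/
def invR (G : Subgroup (GL (Fin d) k)) : Subalgebra k (MvPolynomial (Fin d) k) where
  carrier := {s | ∀ g ∈ G, matAct k d (g : Matrix (Fin d) (Fin d) k) s = s}
  mul_mem' ha hb := fun g hg => by rw [_root_.map_mul, ha g hg, hb g hg]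
  add_mem' ha hb := fun g hg => by rw [_root_.map_add, ha g hg, hb g hg]
  algebraMap_mem' r := fun g hg => (matAct k d _).commutes r

/-- `G ≤ GL_d(k)` is small if it contains no pseudo-reflection (an element `g` with
`rank (g - 1) ≤ 1`) other than the identity. -/
def IsSmall (G : Subgroup (GL (Fin d) k)) : Prop :=
  ∀ g ∈ G, ((g : Matrix (Fin d) (Fin d) k) - 1).rank ≤ 1 → g = 1

variable (G : Subgroup (GL (Fin d) k)) [Fintype G]

/-- The multiplication of the skew group algebra `S*G`, whose underlying `k`-vector space is
`⨁_{g ∈ G} S·g` (encoded as functions `G → S`):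
`(s ⊗ g) · (s' ⊗ g') = s·g(s') ⊗ gg'`. -/
def skewMul (a b : G → MvPolynomial (Fin d) k) : G → MvPolynomial (Fin d) k :=
  fun g => ∑ h : G, a h * matAct k d ((h : GL (Fin d) k) : Matrix (Fin d) (Fin d) k) (b (h⁻¹ * g))

open scoped Classical in
/-- The unit `1 ⊗ 1` of the skew group algebra `S*G`. -/
def skewOne : G → MvPolynomial (Fin d) k := fun g => if g = 1 then 1 else 0

/-- The map `φ : S*G → End_R(S)`, `φ(s ⊗ g)(t) = s·g(t)`, where an element of
`S*G = ⨁_{g ∈ G} S·g` is encoded as a function `a : G → S`. -/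
def skewToEnd (a : G → MvPolynomial (Fin d) k) :
    Module.End ↥(invR k d G) (MvPolynomial (Fin d) k) where
  toFun t := ∑ g : G, a g * matAct k d ((g : GL (Fin d) k) : Matrix (Fin d) (Fin d) k) t
  map_add' x y := by
    simp only [map_add, mul_add]
    rw [Finset.sum_add_distrib]
  map_smul' r t := by
    simp only [RingHom.id_apply, Subalgebra.smul_def, smul_eq_mul, Finset.mul_sum]
    refine Finset.sum_congr rfl fun g _ => ?_
    rw [_root_.map_mul, r.2 (g : GL (Fin d) k) g.2, mul_left_comm]

/-- `matAct` is multiplicative. -/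
theorem matAct_mul (M N : Matrix (Fin d) (Fin d) k) (s : MvPolynomial (Fin d) k) :
    matAct k d (M * N) s = matAct k d M (matAct k d N s) := by
  have : matAct k d (M * N) = (matAct k d M).comp (matAct k d N) := by
    apply MvPolynomial.algHom_ext
    intro i
    simp only [matAct, AlgHom.comp_apply, aeval_X, map_sum, map_smul, Matrix.mul_apply,
      Finset.sum_smul, Finset.smul_sum, smul_smul]
    rw [Finset.sum_comm]
    refine Finset.sum_congr rfl fun j _ => Finset.sum_congr rfl fun l _ => ?_
    rw [mul_comm]
  rw [this]; rfl

theorem matAct_one (s : MvPolynomial (Fin d) k) :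
    matAct k d (1 : Matrix (Fin d) (Fin d) k) s = s := by
  have : matAct k d (1 : Matrix (Fin d) (Fin d) k) = AlgHom.id k _ := by
    apply MvPolynomial.algHom_ext
    intro i
    simp [matAct, Matrix.one_apply, ite_smul]
  rw [this]; rfl

/-- The linear form with given coefficients. -/
def linForm (v : Fin d → k) : MvPolynomial (Fin d) k := ∑ j, v j • X j

theorem matAct_X_sub (M : Matrix (Fin d) (Fin d) k) (i : Fin d) :
    matAct k d M (X i) - X i = linForm k d (fun j => (M - 1) j i) := by
  simp [matAct, linForm, sub_smul, Finset.sum_sub_distrib, Matrix.one_apply, ite_smul]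

theorem linForm_coeff (v : Fin d → k) (j : Fin d) :
    coeff (Finsupp.single j 1) (linForm k d v) = v j := by
  classical
  simp [linForm, coeff_sum, coeff_X', Finsupp.single_left_inj]

theorem linForm_inj {v w : Fin d → k} (h : linForm k d v = linForm k d w) : v = w := by
  funext j
  rw [← linForm_coeff k d v j, h, linForm_coeff]

theorem linForm_smul (c : k) (v : Fin d → k) :
    linForm k d (fun j => v j * c) = linForm k d v * C c := by
  simp only [linForm, Finset.sum_mul]
  refine Finset.sum_congr rfl fun j _ => ?_
  rw [smul_eq_C_mul, smul_eq_C_mul, C_mul]; ring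

theorem linForm_totalDegree (v : Fin d → k) : (linForm k d v).totalDegree ≤ 1 := by
  refine totalDegree_finsetSum_le fun j _ => ?_
  exact (totalDegree_smul_le _ _).trans (by simp)

/-- A matrix whose columns, seen as linear forms, share a prime factor has rank at most one. -/
theorem rank_le_one_of_dvd (M : Matrix (Fin d) (Fin d) k) (p : MvPolynomial (Fin d) k)
    (hp : Prime p) (h : ∀ i, p ∣ linForm k d (fun j => M j i)) : M.rank ≤ 1 := by
  by_cases h0 : ∀ i, linForm k d (fun j => M j i) = 0
  · have : M = 0 := by
      ext j i
      have := linForm_coeff k d (fun j => M j i) j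
      rw [h0 i] at this
      simpa using this.symm
    simp [this]
  push Not at h0
  obtain ⟨i0, hi0⟩ := h0
  have hpd : 1 ≤ p.totalDegree := by
    by_contra hlt
    have h1 : p.totalDegree = 0 := by omega
    rw [totalDegree_eq_zero_iff_eq_C] at h1
    apply hp.not_unit
    rw [h1]
    refine IsUnit.map C (isUnit_iff_ne_zero.2 fun h2 => hp.ne_zero ?_)
    rw [h1, h2, C_0]
  have key : ∀ i, ∃ c : k, linForm k d (fun j => M j i) = p * C c := by
    intro i
    obtain ⟨q, hq⟩ := h i
    by_cases hq0 : q = 0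
    · exact ⟨0, by rw [hq, hq0, C_0]⟩
    have hd := linForm_totalDegree k d (fun j => M j i)
    rw [hq, totalDegree_mul_of_isDomain hp.ne_zero hq0] at hd
    have h1 : q.totalDegree = 0 := by omega
    rw [totalDegree_eq_zero_iff_eq_C] at h1
    exact ⟨_, by rw [hq, ← h1]⟩
  choose c hc using key
  have hc0 : c i0 ≠ 0 := by
    intro h
    apply hi0
    rw [hc, h, C_0, mul_zero]
  have hM : M = Matrix.vecMulVec (fun j => M j i0) (fun i => (c i0)⁻¹ * c i) := by
    ext j i
    rw [Matrix.vecMulVec_apply]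
    refine congrFun (linForm_inj k d (v := fun j => M j i)
      (w := fun j => M j i0 * ((c i0)⁻¹ * c i)) ?_) j
    rw [linForm_smul, hc, hc i0, mul_assoc, ← C_mul, ← mul_assoc, mul_inv_cancel₀ hc0, one_mul]
  rw [hM]
  exact Matrix.rank_vecMulVec_le _ _

/-- The action of `g` on polynomials. -/
abbrev act (g : G) : MvPolynomial (Fin d) k →ₐ[k] MvPolynomial (Fin d) k :=
  matAct k d ((g : GL (Fin d) k) : Matrix (Fin d) (Fin d) k)

theorem act_mul (g h : G) (s : MvPolynomial (Fin d) k) :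
    act k d G (g * h) s = act k d G g (act k d G h s) := by
  simp [act, matAct_mul]

theorem act_one (s : MvPolynomial (Fin d) k) : act k d G 1 s = s := by
  simp [act, matAct_one]

/-- Smallness: trivial inertia at height one primes. -/
theorem inertia (hG : IsSmall k d G) (p : MvPolynomial (Fin d) k) (hp : Prime p) (g h : G)
    (hgh : ∀ s, p ∣ act k d G g s - act k d G h s) : g = h := by
  have h1 : ∀ t, p ∣ act k d G (g * h⁻¹) t - t := by
    intro t
    have := hgh (act k d G h⁻¹ t)
    rwa [← act_mul, ← act_mul, mul_inv_cancel, act_one] at this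
  have h2 := hG (g * h⁻¹ : G) (g * h⁻¹).2 (rank_le_one_of_dvd k d _ p hp fun i => by
    rw [← matAct_X_sub]; exact h1 (X i))
  exact mul_inv_eq_one.1 (Subtype.ext h2)

theorem act_inj (g h : G) (hgh : ∀ s, act k d G g s = act k d G h s) : g = h := by
  apply Subtype.ext
  apply Units.ext
  ext j i
  have := hgh (X i)
  simp only [act, matAct, aeval_X] at this
  exact congrFun (linForm_inj k d (v := fun j => (g : GL (Fin d) k).1 j i)
    (w := fun j => (h : GL (Fin d) k).1 j i) this) j

/-- Dedekind independence after a ring map separating group elements. -/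
theorem dedekind {A : Type} [CommRing A] [IsDomain A] (φ : MvPolynomial (Fin d) k →+* A)
    (hφ : ∀ g h : G, (∀ s, φ (act k d G g s) = φ (act k d G h s)) → g = h)
    (a : G → A) (ha : ∀ s, ∑ g, a g * φ (act k d G g s) = 0) : a = 0 := by
  let F : G → (MvPolynomial (Fin d) k →* A) := fun g =>
    (φ : MvPolynomial (Fin d) k →* A).comp (act k d G g : MvPolynomial (Fin d) k →* _)
  have hF : Function.Injective F := fun g h hgh => hφ g h fun s => DFunLike.congr_fun hgh s
  have := (linearIndependent_monoidHom (MvPolynomial (Fin d) k) A).comp F hF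
  rw [Fintype.linearIndependent_iff] at this
  funext g
  refine this a ?_ g
  funext s
  simpa [F] using ha s

/-- There are elements of `S` with invertible (over the fraction field) matrix of conjugates. -/
theorem exists_det_ne_zero [DecidableEq G] :
    ∃ t : G → MvPolynomial (Fin d) k,
      (Matrix.of fun g i => act k d G g (t i)).det ≠ 0 := by
  let S := MvPolynomial (Fin d) k
  let K := FractionRing S
  let w : S → (G → K) := fun s g => algebraMap S K (act k d G g s)
  have hspan : ⊤ ≤ Submodule.span K (Set.range w) := by
    by_contra hne
    rw [top_le_iff] at hne
    obtain ⟨f, hf0, hf⟩ := Submodule.exists_le_ker_of_lt_top _ (lt_top_iff_ne_top.2 hne)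
    apply hf0
    have h1 : ∀ v : G → K, f v = ∑ g, f (Pi.single g 1) * v g := by
      intro v
      conv_lhs => rw [← Finset.univ_sum_single v, map_sum]
      refine Finset.sum_congr rfl fun g _ => ?_
      have : (Pi.single g (v g) : G → K) = v g • Pi.single g 1 := by
        rw [← Pi.single_smul, smul_eq_mul, mul_one]
      rw [this, map_smul, smul_eq_mul, mul_comm]
    have h2 : (fun g => f (Pi.single g 1)) = 0 := by
      refine dedekind k d G (algebraMap S K) (fun g h hgh => act_inj k d G g h fun s =>
        IsFractionRing.injective S K (hgh s)) _ fun s => ?_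
      rw [← h1 (w s)]
      exact hf (Submodule.subset_span ⟨s, rfl⟩)
    ext v
    simp [congrFun h2]
  let b := Module.Basis.ofSpan hspan
  let e := (Pi.basisFun K G).indexEquiv b
  have hmem : ∀ i : G, ∃ s : S, w s = b (e i) := by
    intro i
    have h1 : Set.range b ⊆ Set.range w := Module.Basis.ofSpan_subset hspan
    exact h1 ⟨e i, rfl⟩
  choose t ht using hmem
  refine ⟨t, fun hdet => ?_⟩
  have hli : LinearIndependent K (fun i => w (t i)) := by
    simp only [ht]
    exact b.linearIndependent.comp e e.injective
  have hu : IsUnit (Matrix.of fun i g => w (t i) g) :=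
    Matrix.linearIndependent_rows_iff_isUnit.1 hli
  rw [Matrix.isUnit_iff_isUnit_det, isUnit_iff_ne_zero] at hu
  apply hu
  have : (Matrix.of fun i g => w (t i) g) =
      ((algebraMap S K).mapMatrix (Matrix.of fun g i => act k d G g (t i)))ᵀ := by
    ext i g; rfl
  rw [this, Matrix.det_transpose, ← RingHom.map_det, hdet, map_zero]

/-- The trace. -/
def trR (s : MvPolynomial (Fin d) k) : invR k d G :=
  ⟨∑ g : G, act k d G g s, fun h hh => by
    rw [map_sum]
    refine Fintype.sum_equiv (Equiv.mulLeft (⟨h, hh⟩ : G)) _ _ fun g => ?_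
    rw [Equiv.coe_mulLeft, act_mul]⟩

/-- An `R`-linear endomorphism vanishing at the `t i` vanishes. -/
theorem end_eq_zero [DecidableEq G] (t : G → MvPolynomial (Fin d) k)
    (ht : (Matrix.of fun g i => act k d G g (t i)).det ≠ 0)
    (f : Module.End ↥(invR k d G) (MvPolynomial (Fin d) k)) (hf : ∀ i, f (t i) = 0) : f = 0 := by
  set N : Matrix G G (MvPolynomial (Fin d) k) := Matrix.of fun g i => act k d G g (t i) with hN
  let ι : invR k d G →+* MvPolynomial (Fin d) k := (invR k d G).subtype
  let T : Matrix G G (invR k d G) := Matrix.of fun i j => trR k d G (t i * t j)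
  have hT : ι.mapMatrix T = Nᵀ * N := by
    ext1 i j
    simp [T, ι, trR, Matrix.mul_apply, hN]
  have hdT : ι T.det = N.det * N.det := by
    rw [RingHom.map_det, hT, Matrix.det_mul, Matrix.det_transpose]
  ext1 s
  let v : G → invR k d G := fun j => trR k d G (t j * s)
  let u : G → MvPolynomial (Fin d) k := fun g => act k d G g s
  have hv : (fun j => ι (v j)) = Nᵀ *ᵥ u := by
    ext1 j
    simp [v, u, ι, trR, Matrix.mulVec, dotProduct, hN]
  let r : G → invR k d G := T.adjugate *ᵥ v
  have hr : (fun j => ι (r j)) = (Nᵀ * N).adjugate *ᵥ (Nᵀ *ᵥ u) := by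
    rw [← hv, ← hT, ← RingHom.map_adjugate]
    ext1 j
    simp [r, Matrix.mulVec, dotProduct]
  have h1 : N *ᵥ (fun j => ι (r j)) = (N.det * N.det) • u := by
    rw [hr, Matrix.adjugate_mul_distrib, Matrix.mulVec_mulVec, Matrix.mulVec_mulVec,
      ← Matrix.mul_assoc, Matrix.mul_assoc, ]
    rw [Matrix.mul_assoc, ← Matrix.mul_assoc N, Matrix.mul_adjugate, Matrix.adjugate_mul,
      Matrix.det_transpose]
    simp [Matrix.smul_mulVec, smul_smul]
  have h2 : T.det • s = ∑ i, r i • t i := by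
    have := congrFun h1 1
    simp only [Matrix.mulVec, dotProduct, hN, Matrix.of_apply, act_one, Pi.smul_apply, u] at this
    rw [← hN, ← hdT, smul_eq_mul] at this
    rw [Subalgebra.smul_def, smul_eq_mul]
    refine this.symm.trans (Finset.sum_congr rfl fun i _ => ?_)
    rw [Subalgebra.smul_def, smul_eq_mul, mul_comm]; rfl
  have h3 : T.det • f s = 0 := by
    rw [← map_smul, h2, map_sum]
    exact Finset.sum_eq_zero fun i _ => by rw [map_smul, hf, smul_zero]
  rw [Subalgebra.smul_def, smul_eq_mul] at h3
  refine (mul_eq_zero.1 h3).resolve_left ?_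
  change ι T.det ≠ 0
  rw [hdT]
  exact mul_ne_zero ht ht

theorem skewToEnd_apply' (a : G → MvPolynomial (Fin d) k) (t : MvPolynomial (Fin d) k) :
    skewToEnd k d G a t = ∑ g, a g * act k d G g t := rfl

/-- Up to a nonzero denominator every endomorphism is in the image. -/
theorem exists_denom (f : Module.End ↥(invR k d G) (MvPolynomial (Fin d) k)) :
    ∃ D : MvPolynomial (Fin d) k, D ≠ 0 ∧ ∃ b : G → MvPolynomial (Fin d) k,
      ∀ s, D * f s = ∑ g, b g * act k d G g s := by
  classical
  obtain ⟨t, ht⟩ := exists_det_ne_zero k d G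
  refine ⟨_, ht, ?_⟩
  set N : Matrix G G (MvPolynomial (Fin d) k) := Matrix.of fun g i => act k d G g (t i) with hN
  let b := (fun i => f (t i)) ᵥ* N.adjugate
  have hb : b ᵥ* N = N.det • fun i => f (t i) := by
    simp [b, Matrix.vecMul_vecMul, Matrix.adjugate_mul, Matrix.vecMul_smul]
  refine ⟨b, fun s => ?_⟩
  let m : Module.End ↥(invR k d G) (MvPolynomial (Fin d) k) :=
    LinearMap.mulLeft ↥(invR k d G) N.det
  have := end_eq_zero k d G t ht (m * f - skewToEnd k d G b) fun i => by
    have := congrFun hb i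
    simp only [Matrix.vecMul, dotProduct, hN, Matrix.of_apply, Pi.smul_apply] at this
    rw [LinearMap.sub_apply, skewToEnd_apply', this, sub_eq_zero]
    rfl
  exact LinearMap.congr_fun (sub_eq_zero.1 this) s

/-- Removing denominators one prime at a time. -/
theorem clear_denom (hG : IsSmall k d G) (f : MvPolynomial (Fin d) k → MvPolynomial (Fin d) k)
    (D : MvPolynomial (Fin d) k) (hD : D ≠ 0) : ∀ b : G → MvPolynomial (Fin d) k,
      (∀ s, D * f s = ∑ g, b g * act k d G g s) →
      ∃ a : G → MvPolynomial (Fin d) k, ∀ s, f s = ∑ g, a g * act k d G g s := by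
  induction D using UniqueFactorizationMonoid.induction_on_prime with
  | h₁ => exact absurd rfl hD
  | h₂ x hx =>
    intro b hb
    obtain ⟨y, hy⟩ := hx.exists_left_inv
    refine ⟨fun g => y * b g, fun s => ?_⟩
    simp only [mul_assoc]
    rw [← Finset.mul_sum, ← hb, ← mul_assoc, hy, one_mul]
  | h₃ D p hD0 hp ih =>
    intro b hb
    let I : Ideal (MvPolynomial (Fin d) k) := Ideal.span {p}
    have hI : I.IsPrime := (Ideal.span_singleton_prime hp.ne_zero).2 hp
    have h1 : (fun g => Ideal.Quotient.mk I (b g)) = 0 := by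
      refine dedekind k d G (Ideal.Quotient.mk I) (fun g h hgh => ?_) _ fun s => ?_
      · refine inertia k d G hG p hp g h fun s => ?_
        exact Ideal.mem_span_singleton.1 (Ideal.Quotient.eq.1 (hgh s))
      · simp only [← map_mul, ← map_sum]
        rw [← hb, Ideal.Quotient.eq_zero_iff_mem, Ideal.mem_span_singleton, mul_assoc]
        exact dvd_mul_right _ _
    have h2 : ∀ g, ∃ c, b g = p * c := fun g => by
      have := congrFun h1 g
      exact Ideal.mem_span_singleton.1 (Ideal.Quotient.eq_zero_iff_mem.1 this)
    choose c hc using h2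
    refine ih hD0 c fun s => mul_left_cancel₀ hp.ne_zero ?_
    rw [← mul_assoc, hb, Finset.mul_sum]
    exact Finset.sum_congr rfl fun g _ => by rw [hc, mul_assoc]

/-- Theorem 3.3, Auslander: for a finite small subgroup `G ≤ GL_d(k)`
(char `k` = 0) with `R = S^G`, the natural map `φ : S*G → End_R(S)`, `φ(s ⊗ g)(t) = s·g(t)`,
is an isomorphism of `k`-algebras; in particular it is bijective. -/
theorem stmt_0 [CharZero k] (hG : IsSmall k d G) :
    Function.Bijective (skewToEnd k d G) ∧
    (∀ a b : G → MvPolynomial (Fin d) k,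
      skewToEnd k d G (skewMul k d G a b) = skewToEnd k d G a * skewToEnd k d G b) ∧
    skewToEnd k d G (skewOne k d G) = 1 ∧
    (∀ (c : k) (a : G → MvPolynomial (Fin d) k),
      skewToEnd k d G (c • a) = c • skewToEnd k d G a) := by
  refine ⟨⟨fun a b hab => ?_, fun f => ?_⟩, fun a b => ?_, ?_, fun c a => ?_⟩
  · have := dedekind k d G (RingHom.id _) (fun g h hgh => act_inj k d G g h hgh)
      (fun g => a g - b g) fun s => by
        have := LinearMap.congr_fun hab s
        rw [skewToEnd_apply', skewToEnd_apply'] at this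
        simp only [RingHom.id_apply, sub_mul, Finset.sum_sub_distrib]
        rw [this, sub_self]
    funext g
    exact sub_eq_zero.1 (congrFun this g)
  · obtain ⟨D, hD, b, hb⟩ := exists_denom k d G f
    obtain ⟨a, ha⟩ := clear_denom k d G hG f D hD b hb
    exact ⟨a, LinearMap.ext fun s => (ha s).symm⟩
  · ext1 s
    rw [Module.End.mul_apply, skewToEnd_apply', skewToEnd_apply', skewToEnd_apply']
    simp only [skewMul, Finset.sum_mul, map_sum, Finset.mul_sum, map_mul]
    rw [Finset.sum_comm]
    refine Finset.sum_congr rfl fun h _ => ?_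
    refine Fintype.sum_equiv (Equiv.mulLeft h⁻¹) _ _ fun g => ?_
    rw [Equiv.coe_mulLeft, ← act_mul, mul_inv_cancel_left, mul_assoc]
  · classical
    ext1 s
    rw [skewToEnd_apply', Finset.sum_eq_single 1]
    · simp [skewOne, act_one]
    · intro g _ hg
      simp [skewOne, hg]
    · simp
  · ext1 s
    rw [LinearMap.smul_apply, skewToEnd_apply', skewToEnd_apply', Finset.smul_sum]
    exact Finset.sum_congr rfl fun g _ => by rw [Pi.smul_apply, smul_mul_assoc]
end
end

section
/- Let R be a commutative Noetherian local Gorenstein ring of Krull dimension d (so R has finite injective dimension d as an R-module, i.e., Ext^i_R(L, R) = 0 for all finitely generated L and all i > d). Let M be a finitely generated R-module with transpose Tr M defined from a finite free presentation, and let N be a finitely generated R-module such that Ext^i_R(N, R) = 0 for all i > 0 and such that N_p is a free R_p-module for every non-maximal prime ideal p of R. Then there is an isomorphism Ext^d_R(Tor_1^R(Tr M, N), R) ≅ Ext^{d+1}_R(Tr M, Hom_R(N, R)). -/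
open CategoryTheory

noncomputable section

namespace S10
variable {R : Type} [CommRing R]

/-- Ext modules in the derived category sense. -/
abbrev E (R : Type) [CommRing R] (L W : Type) [AddCommGroup L] [Module R L] [AddCommGroup W] [Module R W]
   (n : ℕ) : Type := Abelian.Ext (ModuleCat.of R L) (ModuleCat.of R W) n

variable {A B C W : Type} [AddCommGroup A] [Module R A] [AddCommGroup B] [Module R B]
  [AddCommGroup C] [Module R C] [AddCommGroup W] [Module R W]

def pre (f : A →ₗ[R] B) (W : Type) [AddCommGroup W] [Module R W] (n : ℕ) :
    E R B W n →ₗ[R] E R A W n :=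
  (Abelian.Ext.mk₀ (ModuleCat.ofHom f)).precompOfLinear R (ModuleCat.of R W) (zero_add n)

lemma pre_smul (r : R) (n : ℕ) (x : E R A W n) : pre (r • (LinearMap.id : A →ₗ[R] A)) W n x = r • x := by
  change (Abelian.Ext.mk₀ (ModuleCat.ofHom (r • (LinearMap.id : A →ₗ[R] A)))).comp x (zero_add n) = _
  have : ModuleCat.ofHom (r • (LinearMap.id : A →ₗ[R] A)) = r • 𝟙 (ModuleCat.of R A) := by
    ext; simp
  rw [this, Abelian.Ext.mk₀_smul, Abelian.Ext.smul_comp, Abelian.Ext.mk₀_id_comp]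

section LES
variable (f : A →ₗ[R] B) (g : B →ₗ[R] C)

def sc (h : Function.Exact f g) : ShortComplex (ModuleCat R) :=
  ShortComplex.mk (ModuleCat.ofHom f) (ModuleCat.ofHom g) (by
    ext x; simpa using h.apply_apply_eq_zero x)

variable {f g}
lemma sc_se (h : Function.Exact f g) (hf : Function.Injective f) (hg : Function.Surjective g) :
    (sc f g h).ShortExact where
  exact := (ShortComplex.ShortExact.moduleCat_exact_iff_function_exact _).mpr h
  mono_f := (ModuleCat.mono_iff_injective _).mpr hf
  epi_g := (ModuleCat.epi_iff_surjective _).mpr hg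

/-- long exact sequence. -/
lemma les (W : Type) [AddCommGroup W] [Module R W] (n : ℕ)
    (h : Function.Exact f g) (hf : Function.Injective f) (hg : Function.Surjective g) :
    ∃ δ : E R A W n →ₗ[R] E R C W (n+1),
      Function.Exact (pre g W n) (pre f W n) ∧ Function.Exact (pre f W n) δ ∧
      Function.Exact δ (pre g W (n+1)) := by
  let hS := sc_se h hf hg
  have h1 := Abelian.Ext.contravariant_sequence_exact₂' hS (ModuleCat.of R W) n
  have h2 := Abelian.Ext.contravariant_sequence_exact₁' hS (ModuleCat.of R W) n (n+1) (add_comm 1 n)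
  have h3 := Abelian.Ext.contravariant_sequence_exact₃' hS (ModuleCat.of R W) n (n+1) (add_comm 1 n)
  rw [ShortComplex.ab_exact_iff_function_exact] at h1 h2 h3
  exact ⟨hS.extClass.precompOfLinear R (ModuleCat.of R W) (add_comm 1 n), h1, h2, h3⟩

lemma pre_inj0 (hg : Function.Surjective g) : Function.Injective (pre g W 0) := by
  have : Epi (ModuleCat.ofHom g) := (ModuleCat.epi_iff_surjective _).mpr hg
  exact Abelian.Ext.precomp_mk₀_injective_of_epi (ModuleCat.of R W) (ModuleCat.ofHom g)

lemma sub_mid (n : ℕ)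
    (h : Function.Exact f g) (hf : Function.Injective f) (hg : Function.Surjective g)
    (hA : Subsingleton (E R A W n)) (hC : Subsingleton (E R C W n)) : Subsingleton (E R B W n) := by
  obtain ⟨δ, h1, h2, h3⟩ := les W n h hf hg
  refine subsingleton_of_forall_eq 0 fun x => ?_
  obtain ⟨y, rfl⟩ := (h1 x).1 (Subsingleton.elim _ _)
  rw [Subsingleton.elim y 0, map_zero]

lemma sub_left (n : ℕ)
    (h : Function.Exact f g) (hf : Function.Injective f) (hg : Function.Surjective g)
    (hB : Subsingleton (E R B W n)) (hC : Subsingleton (E R C W (n+1))) :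
    Subsingleton (E R A W n) := by
  obtain ⟨δ, h1, h2, h3⟩ := les W n h hf hg
  refine subsingleton_of_forall_eq 0 fun x => ?_
  obtain ⟨y, rfl⟩ := (h2 x).1 (Subsingleton.elim _ _)
  rw [Subsingleton.elim y 0, map_zero]

lemma sub_right (n : ℕ)
    (h : Function.Exact f g) (hf : Function.Injective f) (hg : Function.Surjective g)
    (hA : Subsingleton (E R A W n)) (hB : Subsingleton (E R B W (n+1))) :
    Subsingleton (E R C W (n+1)) := by
  obtain ⟨δ, h1, h2, h3⟩ := les W n h hf hg
  refine subsingleton_of_forall_eq 0 fun x => ?_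
  obtain ⟨y, rfl⟩ := (h3 x).1 (Subsingleton.elim _ _)
  rw [Subsingleton.elim y 0, map_zero]

lemma sub_of_sub (n : ℕ) (hA : Subsingleton A) : Subsingleton (E R A W n) := by
  cases n with
  | zero =>
    refine (Abelian.Ext.addEquiv₀ (X := ModuleCat.of R A) (Y := ModuleCat.of R W)).subsingleton_congr.2 ?_
    refine ⟨fun a b => ModuleCat.hom_ext (LinearMap.ext fun x => ?_)⟩
    have hx : x = 0 := Subsingleton.elim (α := A) x 0
    rw [hx, map_zero, map_zero]
  | succ n =>
    have : Module.Projective R A := inferInstance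
    have : Projective (ModuleCat.of R A) := inferInstance
    exact Abelian.Ext.subsingleton_of_projective _ _ _

lemma sub_equiv (n : ℕ) (e : A ≃ₗ[R] B) (hB : Subsingleton (E R B W n)) : Subsingleton (E R A W n) := by
  have : Function.Exact (0 : PUnit →ₗ[R] A) e.toLinearMap := by
    intro x; simp [eq_comm (a := (0:A))]
  exact sub_mid (A := PUnit) (f := 0) (g := e.toLinearMap) n this (fun _ _ _ => rfl) e.surjective
    (sub_of_sub n inferInstance) hB
end LES

end S10

namespace S10
variable {R : Type} [CommRing R] [IsNoetherianRing R] [IsLocalRing R]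
open IsLocalRing

instance E_finite (A W : Type) [AddCommGroup A] [Module R A] [AddCommGroup W] [Module R W]
    [Module.Finite R A] [Module.Finite R W] (n : ℕ) : Module.Finite R (E R A W n) :=
  ModuleCat.finite_ext R (ModuleCat.of R A) (ModuleCat.of R W) n

lemma bass_prime (i : ℕ) (h : ∀ (L : Type) [AddCommGroup L] [Module R L] [Module.Finite R L],
      Subsingleton (E R L R (i+1)))
    (p : Ideal R) [p.IsPrime] (hp : p ≠ maximalIdeal R) : Subsingleton (E R (R ⧸ p) R i) := by
  obtain ⟨x, hxm, hxp⟩ : ∃ x ∈ maximalIdeal R, x ∉ p := by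
    by_contra! hcon
    exact hp (le_antisymm (le_maximalIdeal ‹p.IsPrime›.ne_top) hcon)
  let f : (R ⧸ p) →ₗ[R] (R ⧸ p) := x • LinearMap.id
  have hf : Function.Injective f := by
    rw [← LinearMap.ker_eq_bot, LinearMap.ker_eq_bot']
    intro y hy
    obtain ⟨y, rfl⟩ := Ideal.Quotient.mk_surjective y
    have : Ideal.Quotient.mk p (x * y) = 0 := hy
    rw [Ideal.Quotient.eq_zero_iff_mem] at this ⊢
    exact (‹p.IsPrime›.mem_or_mem this).resolve_left hxp
  obtain ⟨δ, h1, h2, h3⟩ := les R i (f.exact_map_mkQ_range) hf (Submodule.mkQ_surjective _)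
  have hs : Function.Surjective (pre f R i) := fun y => by
    have := h ((R ⧸ p) ⧸ LinearMap.range f)
    exact (h2 y).1 (Subsingleton.elim _ _)
  have key : (⊤ : Submodule R (E R (R ⧸ p) R i)) ≤ maximalIdeal R • ⊤ := by
    intro y _
    obtain ⟨z, rfl⟩ := hs y
    rw [pre_smul]
    exact Submodule.smul_mem_smul hxm trivial
  have := Submodule.eq_bot_of_le_smul_of_le_jacobson_bot (maximalIdeal R) ⊤ Module.Finite.fg_top key
    (maximalIdeal_le_jacobson _)
  exact (Submodule.subsingleton_iff R).1 (subsingleton_of_bot_eq_top this.symm)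

lemma bass (i : ℕ) (h : ∀ (L : Type) [AddCommGroup L] [Module R L] [Module.Finite R L],
      Subsingleton (E R L R (i+1)))
    (hk : Subsingleton (E R (R ⧸ maximalIdeal R) R i)) (L : Type) [AddCommGroup L] [Module R L]
    [Module.Finite R L] : Subsingleton (E R L R i) := by
  refine IsNoetherianRing.induction_on_isQuotientEquivQuotientPrime R (M := L) inferInstance
    (motive := fun N _ _ _ => Subsingleton (E R N R i)) ?_ ?_ ?_
  · intro N _ _ _ hN
    exact sub_of_sub i hN
  · intro N _ _ _ p e
    refine sub_equiv i e ?_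
    by_cases hp : p.asIdeal = maximalIdeal R
    · rw [hp]; exact hk
    · exact bass_prime i h p.asIdeal hp
  · intro A _ _ _ B _ _ _ C _ _ _ f g hf hg hfg hA hC
    exact sub_mid i hfg hf hg hA hC

lemma bass_down (t d : ℕ) (hG : ∀ (L : Type) [AddCommGroup L] [Module R L] [Module.Finite R L],
      ∀ i, d < i → Subsingleton (E R L R i))
    (Q : Type) [AddCommGroup Q] [Module R Q] [Module.Finite R Q]
    (hQ : ∀ i, t < i → Subsingleton (E R Q R i))
    (φ : (R ⧸ maximalIdeal R) →ₗ[R] Q) (hφ : Function.Injective φ) :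
    ∀ (L : Type) [AddCommGroup L] [Module R L] [Module.Finite R L],
      ∀ i, t < i → Subsingleton (E R L R i) := by
  have key : ∀ n : ℕ, ∀ (L : Type) [AddCommGroup L] [Module R L] [Module.Finite R L],
      ∀ i, t < i → d < i + n → Subsingleton (E R L R i) := by
    intro n
    induction n with
    | zero => intro L _ _ _ i _ h; exact hG L i h
    | succ n ih =>
      intro L _ _ _ i hi h
      refine bass i (fun L _ _ _ => ih L (i+1) (by omega) (by omega)) ?_ L
      exact sub_left i φ.exact_map_mkQ_range hφ (Submodule.mkQ_surjective _) (hQ i hi)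
        (ih _ (i+1) (by omega) (by omega))
  intro L _ _ _ i hi
  exact key (d+1) L i hi (by omega)

lemma dim_le_of (t : ℕ) (rs : List R) (hlen : rs.length = t)
    (hmem : ∀ r ∈ rs, r ∈ maximalIdeal R)
    (h : ∀ p : Ideal R, p.IsPrime → Ideal.ofList rs ≤ p → p = maximalIdeal R) :
    ringKrullDim R ≤ t := by
  classical
  have hle : Ideal.ofList rs ≤ maximalIdeal R := by
    rw [Ideal.ofList, Ideal.span_le]; exact hmem
  have hmin : maximalIdeal R ∈ (Ideal.ofList rs).minimalPrimes :=
    ⟨⟨inferInstance, hle⟩, fun p hp _ => (h p hp.1 hp.2).ge⟩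
  have h1 := Ideal.height_le_spanRank_toENat_of_mem_minimalPrimes _ _ hmin
  have h2 : (Submodule.spanRank (Ideal.ofList rs)).toENat ≤ t := by
    have : Submodule.spanRank (Ideal.ofList rs) ≤ (t : Cardinal) := by
      have h3 : Ideal.ofList rs = Submodule.span R (rs.toFinset : Set R) := by
        rw [Ideal.ofList]; congr 1; ext; simp
      rw [h3]
      refine (Submodule.spanRank_span_le_card _).trans ?_
      have h4 : Cardinal.mk (rs.toFinset : Set R) = (rs.toFinset.card : Cardinal) := Cardinal.mk_coe_finset
      rw [h4]
      exact_mod_cast (List.toFinset_card_le rs).trans hlen.le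
    simpa using (Cardinal.toENat.monotone' this)
  rw [← maximalIdeal_height_eq_ringKrullDim]
  exact_mod_cast h1.trans h2

lemma exists_embedding (rs : List R) (hreg : RingTheory.Sequence.IsRegular R rs)
    (hmem : ∀ r ∈ rs, r ∈ maximalIdeal R)
    (ht : ¬ Subsingleton (E R (R ⧸ maximalIdeal R) R rs.length)) :
    ∃ φ : (R ⧸ maximalIdeal R) →ₗ[R] (R ⧸ Ideal.ofList rs), Function.Injective φ := by
  by_cases hsub : Subsingleton ((R ⧸ maximalIdeal R) →ₗ[R] (R ⧸ Ideal.ofList rs))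
  · exfalso
    obtain ⟨x, hx, hxr⟩ := IsSMulRegular.subsingleton_linearMap_iff.1 hsub
    rw [Ideal.annihilator_quotient] at hx
    apply ht
    have hmem2 : ∀ r ∈ rs ++ [x], r ∈ maximalIdeal R := by
      intro r hr
      rcases List.mem_append.1 hr with h | h
      · exact hmem r h
      · rw [List.mem_singleton] at h; exact h ▸ hx
    have hsm : maximalIdeal R • (⊤ : Submodule R R) < ⊤ := by
      simpa using (Ideal.IsPrime.ne_top' : maximalIdeal R ≠ ⊤).lt_top
    have hreg2 : RingTheory.Sequence.IsRegular R (rs ++ [x]) := by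
      refine ⟨(RingTheory.Sequence.isWeaklyRegular_append_iff R rs [x]).2 ⟨hreg.1, ?_⟩, ?_⟩
      · rw [RingTheory.Sequence.isWeaklyRegular_singleton_iff]
        have e : Ideal.ofList rs • (⊤ : Submodule R R) = Ideal.ofList rs := by simp
        rw [e]; exact hxr
      · intro h
        refine hsm.not_ge (h.le.trans (Submodule.smul_mono_left ?_))
        rw [Ideal.ofList, Ideal.span_le]; exact hmem2
    refine ModuleCat.subsingleton_ext_of_exists_isRegular (maximalIdeal R)
      (ModuleCat.of R (R ⧸ maximalIdeal R)) ?_ (ModuleCat.of R R) hsm (rs ++ [x]) hmem2 hreg2 _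
      (by simp)
    change Module.support R (R ⧸ maximalIdeal R) ⊆ _
    rw [Module.support_eq_zeroLocus, Ideal.annihilator_quotient]
  · rw [not_subsingleton_iff_nontrivial] at hsub
    obtain ⟨φ, hφ⟩ := exists_ne (0 : (R ⧸ maximalIdeal R) →ₗ[R] (R ⧸ Ideal.ofList rs))
    refine ⟨φ, ?_⟩
    have : IsSimpleModule R (R ⧸ maximalIdeal R) := by
      exact isSimpleModule_iff_isCoatom.2 (Ideal.isMaximal_def.1 inferInstance)
    exact (LinearMap.injective_or_eq_zero φ).resolve_right hφ

theorem ext_residue (d : ℕ) (hdim : ringKrullDim R = d)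
    (hG : ∀ (L : Type) [AddCommGroup L] [Module R L] [Module.Finite R L],
      ∀ i, d < i → Subsingleton (E R L R i)) :
    ∀ i < d, Subsingleton (E R (R ⧸ maximalIdeal R) R i) := by
  classical
  by_contra hcon
  have hex : ∃ t, t < d ∧ ¬ Subsingleton (E R (R ⧸ maximalIdeal R) R t) := by
    by_contra! h; exact hcon h
  let t := Nat.find hex
  obtain ⟨htd, ht⟩ : t < d ∧ _ := Nat.find_spec hex
  have hlt : ∀ i < t, Subsingleton (E R (R ⧸ maximalIdeal R) R i) := fun i hi => by
    have := Nat.find_min hex hi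
    by_contra h
    exact this ⟨by omega, h⟩
  have hsm : maximalIdeal R • (⊤ : Submodule R R) < ⊤ := by
    simpa using (Ideal.IsPrime.ne_top' : maximalIdeal R ≠ ⊤).lt_top
  have hsupp : Module.support R (R ⧸ maximalIdeal R) = PrimeSpectrum.zeroLocus (maximalIdeal R) := by
    rw [Module.support_eq_zeroLocus, Ideal.annihilator_quotient]
  obtain ⟨rs, hlen, hmem, hreg⟩ := ModuleCat.exists_isRegular_of_exists_subsingleton_ext
    (maximalIdeal R) t (ModuleCat.of R R) hsm (ModuleCat.of R (R ⧸ maximalIdeal R)) hsupp hlt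
  change RingTheory.Sequence.IsRegular R rs at hreg
  rw [show Nat.find hex = rs.length from hlen.symm] at ht
  obtain ⟨φ, hφ⟩ := exists_embedding rs hreg hmem ht
  have hpd : ∀ i, rs.length < i → Subsingleton (E R (R ⧸ Ideal.ofList rs) R i) := by
    intro i hi
    have h1 := ModuleCat.projectiveDimension_quotient_eq_length.{0} rs hreg
    have h2 := (projectiveDimension_le_iff _ _).1 h1.le
    have h3 := HasProjectiveDimensionLT.subsingleton (hX := h2) _ (rs.length + 1) i hi (ModuleCat.of R R)
    exact sub_equiv i (Shrink.linearEquiv R (R ⧸ Ideal.ofList rs)).symm h3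
  have hall := bass_down rs.length d hG (R ⧸ Ideal.ofList rs) hpd φ hφ
  have hle : Ideal.ofList rs ≤ maximalIdeal R := by
    rw [Ideal.ofList, Ideal.span_le]; exact hmem
  have hprimes : ∀ p : Ideal R, p.IsPrime → Ideal.ofList rs ≤ p → p = maximalIdeal R := by
    intro p hp hIp
    by_contra hpm
    have h1 := bass_prime rs.length (fun L _ _ _ => hall L _ (by omega)) p hpm
    have hpm' := le_maximalIdeal hp.ne_top
    let g : (R ⧸ p) →ₗ[R] (R ⧸ maximalIdeal R) := Submodule.mapQ p (maximalIdeal R) LinearMap.id hpm'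
    have hg : Function.Surjective g := by
      intro y
      obtain ⟨y, rfl⟩ := Ideal.Quotient.mk_surjective y
      exact ⟨Ideal.Quotient.mk p y, rfl⟩
    apply ht
    by_cases h0 : rs.length = 0
    · rw [h0] at h1 ⊢
      exact (pre_inj0 hg).subsingleton
    · obtain ⟨m, hm⟩ := Nat.exists_eq_succ_of_ne_zero h0
      rw [hm] at h1 ⊢
      refine sub_right m (f := (LinearMap.ker g).subtype) (LinearMap.exact_subtype_ker_map g)
        (Submodule.injective_subtype _) hg ?_ h1
      have hsm2 : Ideal.ofList rs • (⊤ : Submodule R R) < ⊤ :=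
        lt_of_le_of_lt (Submodule.smul_mono_left hle) hsm
      refine ModuleCat.subsingleton_ext_of_exists_isRegular (Ideal.ofList rs)
        (ModuleCat.of R (LinearMap.ker g)) ?_ (ModuleCat.of R R) hsm2 rs
        (fun r hr => Ideal.subset_span hr) hreg m (by omega)
      change Module.support R (LinearMap.ker g) ⊆ _
      rw [Module.support_eq_zeroLocus]
      refine PrimeSpectrum.zeroLocus_anti_mono ?_
      intro r hr
      have : r ∈ Module.annihilator R (R ⧸ p) := by
        rw [Ideal.annihilator_quotient]; exact hIp hr
      rw [SetLike.mem_coe, Module.mem_annihilator] at *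
      intro y
      exact Subtype.ext (this y.1)
  have := dim_le_of rs.length rs rfl hmem hprimes
  rw [hdim] at this
  have : d ≤ rs.length := by exact_mod_cast this
  omega

/-- Cohen-Macaulay vanishing. -/
theorem ext_support (d : ℕ) (hdim : ringKrullDim R = d)
    (hG : ∀ (L : Type) [AddCommGroup L] [Module R L] [Module.Finite R L],
      ∀ i, d < i → Subsingleton (E R L R i))
    (T : Type) [AddCommGroup T] [Module R T] [Module.Finite R T]
    (hT : Module.support R T ⊆ PrimeSpectrum.zeroLocus (maximalIdeal R)) :
    ∀ i < d, Subsingleton (E R T R i) := by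
  have hsm : maximalIdeal R • (⊤ : Submodule R R) < ⊤ := by
    simpa using (Ideal.IsPrime.ne_top' : maximalIdeal R ≠ ⊤).lt_top
  have hsupp : Module.support R (R ⧸ maximalIdeal R) = PrimeSpectrum.zeroLocus (maximalIdeal R) := by
    rw [Module.support_eq_zeroLocus, Ideal.annihilator_quotient]
  obtain ⟨rs, hlen, hmem, hreg⟩ := ModuleCat.exists_isRegular_of_exists_subsingleton_ext
    (maximalIdeal R) d (ModuleCat.of R R) hsm (ModuleCat.of R (R ⧸ maximalIdeal R)) hsupp
    (ext_residue d hdim hG)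
  intro i hi
  exact ModuleCat.subsingleton_ext_of_exists_isRegular (maximalIdeal R) (ModuleCat.of R T) hT
    (ModuleCat.of R R) hsm rs hmem hreg i (by omega)

end S10

namespace S10
section bridge
open CochainComplex.HomComplex ProjectiveResolution
variable {R : Type} [CommRing R]

lemma extMk_zero_iff0 {L W : ModuleCat.{0} R} (P : ProjectiveResolution L) (f : P.complex.X 0 ⟶ W)
    (hf : P.complex.d 1 0 ≫ f = 0) : P.extMk f 1 rfl hf = 0 ↔ f = 0 := by
  constructor
  · intro h
    simp only [← P.extEquivCohomologyClass.apply_eq_iff_eq,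
      extEquivCohomologyClass_extMk, extEquivCohomologyClass_zero,
      CohomologyClass.mk_eq_zero_iff] at h
    rw [Cocycle.toSingleMk_mem_coboundaries_iff _ _ _ _ _ 1 (by simp)] at h
    obtain ⟨g, hg⟩ := h
    have : P.cochainComplex.d (-(0 : ℕ) : ℤ) 1 = 0 := by
      apply Limits.IsZero.eq_of_tgt
      exact P.cochainComplex.isZero_of_isStrictlyLE 0 1 (by simp)
    rw [this, Limits.zero_comp] at hg
    rw [← cancel_epi (P.cochainComplexXIso (-(0:ℕ)) 0 rfl).hom, Limits.comp_zero]
    exact hg.symm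
  · rintro rfl; exact P.extMk_zero 1 rfl

lemma extMk_iff {L W : ModuleCat.{0} R} (P : ProjectiveResolution L) (n : ℕ) (f : P.complex.X n ⟶ W)
    (hf : P.complex.d (n+1) n ≫ f = 0) : P.extMk f (n+1) rfl hf = 0 ↔ 
      ∃ g : P.complex.X (n-1) ⟶ W, P.complex.d n (n-1) ≫ g = f := by
  cases n with
  | zero => 
    rw [extMk_zero_iff0]
    constructor
    · rintro rfl; exact ⟨0, by simp⟩
    · rintro ⟨g, rfl⟩
      rw [P.complex.shape _ _ (by simp), Limits.zero_comp]
  | succ n => exact P.extMk_eq_zero_iff f _ rfl hf n rfl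

def bridgeMap {L W : ModuleCat.{0} R} (P : ProjectiveResolution L) (n : ℕ) :
    LinearMap.ker (Linear.leftComp R W (P.complex.d (n+1) n)) →ₗ[R] Abelian.Ext L W n where
  toFun f := P.extMk f.1 (n+1) rfl f.2
  map_add' f g := (P.add_extMk _ _ _ _ _ _).symm
  map_smul' r f := by
    have h := P.extMk_comp_mk₀ f.1 (n+1) rfl f.2 (r • 𝟙 W)
    simp only [Linear.comp_smul, Category.comp_id] at h
    have h2 := Abelian.Ext.smul_eq_comp_mk₀ (P.extMk f.1 (n+1) rfl f.2) r
    refine Eq.trans ?_ (h2.trans h).symm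
    congr 1

theorem bridge (L W : ModuleCat.{0} R) (n : ℕ) :
    Nonempty ((((Ext R (ModuleCat R) n).obj (Opposite.op L)).obj W) ≃ₗ[R] Abelian.Ext L W n) := by
  let P : ProjectiveResolution L := ProjectiveResolution.of L
  let K := P.complex.linearYonedaObj R W
  have hprev : (ComplexShape.up ℕ).prev n = n - 1 := by
    cases n <;> simp
  let S := K.sc' (n-1) n (n+1)
  let e1 : (((Ext R (ModuleCat R) n).obj (Opposite.op L)).obj W) ≅ S.moduleCatLeftHomologyData.H :=
    P.isoExt n W ≪≫ 
    ShortComplex.homologyMapIso (K.isoSc' (n-1) n (n+1) hprev (by simp)) ≪≫ S.moduleCatHomologyIso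
  suffices e2 : Nonempty ((S.moduleCatLeftHomologyData.H : Type) ≃ₗ[R] Abelian.Ext L W n) from
    ⟨e1.toLinearEquiv.trans e2.some⟩
  have hs : Function.Surjective (bridgeMap (W := W) P n) := fun y => by
    obtain ⟨f, hf, rfl⟩ := P.extMk_surjective y (n+1) rfl
    exact ⟨⟨f, hf⟩, rfl⟩
  refine ⟨?_⟩
  refine LinearEquiv.trans (Submodule.quotEquivOfEq (R := R) _ (LinearMap.ker (bridgeMap (W := W) P n)) ?_)
    (LinearMap.quotKerEquivOfSurjective _ hs)
  ext ⟨z, hz⟩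
  refine Iff.trans ?_ (extMk_iff P n z hz).symm
  constructor
  · rintro ⟨y, hy⟩
    exact ⟨y, congrArg Subtype.val hy⟩
  · rintro ⟨y, hy⟩
    exact ⟨y, Subtype.ext hy⟩

end bridge
end S10

namespace S10
section tor
variable {R : Type} [CommRing R]

/-- Zigzag isomorphism. -/
lemma zigzag {P2 P1 P0 PN Y1 Y0 YN X2 X1 X0 : Type}
    [AddCommGroup P2] [AddCommGroup P1] [AddCommGroup P0] [AddCommGroup PN]
    [AddCommGroup Y1] [AddCommGroup Y0] [AddCommGroup YN]
    [AddCommGroup X2] [AddCommGroup X1] [AddCommGroup X0]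
    [Module R P2] [Module R P1] [Module R P0] [Module R PN]
    [Module R Y1] [Module R Y0] [Module R YN]
    [Module R X2] [Module R X1] [Module R X0]
    (p2 : P2 →ₗ[R] P1) (p1 : P1 →ₗ[R] P0) (p0 : P0 →ₗ[R] PN)
    (y1 : Y1 →ₗ[R] Y0) (y0 : Y0 →ₗ[R] YN)
    (x2 : X2 →ₗ[R] X1) (x1 : X1 →ₗ[R] X0)
    (i1 : Y1 →ₗ[R] P1) (i0 : Y0 →ₗ[R] P0) (iN : YN →ₗ[R] PN)
    (q2 : P2 →ₗ[R] X2) (q1 : P1 →ₗ[R] X1) (q0 : P0 →ₗ[R] X0)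
    (ep1 : Function.Exact p2 p1) (ep0 : Function.Exact p1 p0)
    (ey0 : Function.Exact y1 y0) (sy0 : Function.Surjective y0)
    (hi0 : Function.Injective i0) (sq2 : Function.Surjective q2) (sq1 : Function.Surjective q1)
    (e1 : Function.Exact i1 q1) (e0 : Function.Exact i0 q0)
    (c1 : ∀ y, i0 (y1 y) = p1 (i1 y)) (c0 : ∀ y, iN (y0 y) = p0 (i0 y))
    (k2 : ∀ p, q1 (p2 p) = x2 (q2 p)) (k1 : ∀ p, q0 (p1 p) = x1 (q1 p)) :
    Nonempty ((LinearMap.ker x1 ⧸ (LinearMap.range x2).comap (LinearMap.ker x1).subtype) ≃ₗ[R]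
      LinearMap.ker iN) := by
  let Z := (LinearMap.range i0).comap p1
  let α0 : Z →ₗ[R] LinearMap.ker x1 := (q1 ∘ₗ Z.subtype).codRestrict _ (by
    rintro ⟨z, y, hy⟩
    simp only [LinearMap.comp_apply, Submodule.subtype_apply, LinearMap.mem_ker]
    rw [← k1, ← hy]; exact e0.apply_apply_eq_zero y)
  let α := ((LinearMap.range x2).comap (LinearMap.ker x1).subtype).mkQ ∘ₗ α0
  have hα : Function.Surjective α := by
    refine (Submodule.mkQ_surjective _).comp ?_
    rintro ⟨x, hx⟩
    obtain ⟨p, rfl⟩ := sq1 x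
    rw [LinearMap.mem_ker, ← k1] at hx
    exact ⟨⟨p, (e0 _).1 hx⟩, rfl⟩
  let j : Y0 ≃ₗ[R] LinearMap.range i0 := LinearEquiv.ofInjective i0 hi0
  have hj : ∀ z : LinearMap.range i0, i0 (j.symm z) = z.1 := fun z => by
    conv_rhs => rw [← j.apply_symm_apply z]
    rfl
  let γ : Z →ₗ[R] Y0 := j.symm.toLinearMap ∘ₗ (p1 ∘ₗ Z.subtype).codRestrict _ (fun z => z.2)
  have hγ : ∀ z : Z, i0 (γ z) = p1 z.1 := fun z => hj _
  let β : Z →ₗ[R] LinearMap.ker iN := (y0 ∘ₗ γ).codRestrict _ (fun z => by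
    rw [LinearMap.mem_ker, LinearMap.comp_apply, c0, hγ, ep0.apply_apply_eq_zero])
  have hβ : Function.Surjective β := by
    rintro ⟨t, ht⟩
    obtain ⟨y, rfl⟩ := sy0 t
    rw [LinearMap.mem_ker, c0] at ht
    obtain ⟨w, hw⟩ := (ep0 _).1 ht
    refine ⟨⟨w, y, hw.symm⟩, Subtype.ext ?_⟩
    change y0 (γ _) = y0 y
    congr 1
    apply hi0
    rw [hγ]; exact hw
  have hker : LinearMap.ker α = LinearMap.ker β := by
    ext z
    have ha : z ∈ LinearMap.ker α ↔ ∃ x, x2 x = q1 z.1 := by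
      simp only [α, LinearMap.mem_ker, LinearMap.comp_apply, Submodule.mkQ_apply,
        Submodule.Quotient.mk_eq_zero, Submodule.mem_comap, LinearMap.mem_range]
      rfl
    have hb : z ∈ LinearMap.ker β ↔ y0 (γ z) = 0 := by
      rw [LinearMap.mem_ker, ← Subtype.coe_inj]; rfl
    rw [ha, hb]
    constructor
    · rintro ⟨x, hx⟩
      obtain ⟨p, rfl⟩ := sq2 x
      have : q1 (z.1 - p2 p) = 0 := by rw [map_sub, ← hx, k2, sub_self]
      obtain ⟨y, hy⟩ := (e1 _).1 this
      refine (ey0 _).2 ⟨y, hi0 ?_⟩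
      rw [c1, hγ, hy, map_sub, ep1.apply_apply_eq_zero, sub_zero]
    · intro h
      obtain ⟨y, hy⟩ := (ey0 _).1 h
      have : p1 (z.1 - i1 y) = 0 := by rw [map_sub, ← c1, hy, hγ, sub_self]
      obtain ⟨p, hp⟩ := (ep1 _).1 this
      refine ⟨q2 p, ?_⟩
      rw [← k2, hp, map_sub, e1.apply_apply_eq_zero, sub_zero]
  exact ⟨(α.quotKerEquivOfSurjective hα).symm.trans
    ((Submodule.quotEquivOfEq _ _ hker).trans (β.quotKerEquivOfSurjective hβ))⟩

open TensorProduct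
theorem tor_iso {X Y P N : Type} [AddCommGroup X] [AddCommGroup Y] [AddCommGroup P] [AddCommGroup N]
    [Module R X] [Module R Y] [Module R P] [Module R N] [Module.Flat R P]
    (i : Y →ₗ[R] P) (q : P →ₗ[R] X) (h : Function.Exact i q) (hi : Function.Injective i)
    (hq : Function.Surjective q) :
    Nonempty ((((Tor (ModuleCat R) 1).obj (ModuleCat.of R X)).obj (ModuleCat.of R N)) ≃ₗ[R]
      LinearMap.ker (i.rTensor N)) := by
  let Q : ProjectiveResolution (ModuleCat.of R N) := ProjectiveResolution.of _
  let K := ((((MonoidalCategory.tensoringLeft (ModuleCat R)).obj (ModuleCat.of R X)).mapHomologicalComplex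
    (ComplexShape.down ℕ)).obj Q.complex)
  let S := K.sc' 2 1 0
  let e1 : (((Tor (ModuleCat R) 1).obj (ModuleCat.of R X)).obj (ModuleCat.of R N)) ≅
      S.moduleCatLeftHomologyData.H :=
    Q.isoLeftDerivedObj _ 1 ≪≫
    ShortComplex.homologyMapIso (K.isoSc' 2 1 0 (by simp) (by simp)) ≪≫ S.moduleCatHomologyIso
  suffices e2 : Nonempty ((S.moduleCatLeftHomologyData.H : Type) ≃ₗ[R] LinearMap.ker (i.rTensor N)) from
    ⟨e1.toLinearEquiv.trans e2.some⟩
  let d2 : Q.complex.X 2 →ₗ[R] Q.complex.X 1 := (Q.complex.d 2 1).hom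
  let d1 : Q.complex.X 1 →ₗ[R] Q.complex.X 0 := (Q.complex.d 1 0).hom
  let d0 : Q.complex.X 0 →ₗ[R] N := (Q.π.f 0).hom
  have ed1 : Function.Exact d2 d1 :=
    (ShortComplex.ShortExact.moduleCat_exact_iff_function_exact _).1 (Q.exact_succ 0)
  have ed0 : Function.Exact d1 d0 :=
    (ShortComplex.ShortExact.moduleCat_exact_iff_function_exact _).1 (Q.exact₀)
  have sd0 : Function.Surjective d0 := 
    (ModuleCat.epi_iff_surjective (Q.π.f 0)).1 inferInstance
  have : Module.Projective R (Q.complex.X 0) := 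
    (IsProjective.iff_projective (R := R) (Q.complex.X 0)).2 (Q.projective 0)
  obtain ⟨e⟩ := zigzag (d2.lTensor P) (d1.lTensor P) (d0.lTensor P)
    (d1.lTensor Y) (d0.lTensor Y) (d2.lTensor X) (d1.lTensor X)
    (i.rTensor _) (i.rTensor _) (i.rTensor _) (q.rTensor _) (q.rTensor _) (q.rTensor _)
    (Module.Flat.lTensor_exact P ed1) (Module.Flat.lTensor_exact P ed0)
    (lTensor_exact Y ed0 sd0) (LinearMap.lTensor_surjective Y sd0)
    (Module.Flat.rTensor_preserves_injective_linearMap i hi)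
    (LinearMap.rTensor_surjective _ hq) (LinearMap.rTensor_surjective _ hq)
    (rTensor_exact _ h hq) (rTensor_exact _ h hq)
    (fun y => by 
      rw [← LinearMap.comp_apply, ← LinearMap.comp_apply, LinearMap.rTensor_comp_lTensor, LinearMap.lTensor_comp_rTensor])
    (fun y => by 
      rw [← LinearMap.comp_apply, ← LinearMap.comp_apply, LinearMap.rTensor_comp_lTensor, LinearMap.lTensor_comp_rTensor])
    (fun y => by 
      rw [← LinearMap.comp_apply, ← LinearMap.comp_apply, LinearMap.rTensor_comp_lTensor, LinearMap.lTensor_comp_rTensor])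
    (fun y => by 
      rw [← LinearMap.comp_apply, ← LinearMap.comp_apply, LinearMap.rTensor_comp_lTensor, LinearMap.lTensor_comp_rTensor])
  refine ⟨?_⟩
  refine LinearEquiv.trans (Submodule.quotEquivOfEq (R := R) _
    ((LinearMap.range (d2.lTensor X)).comap (LinearMap.ker (d1.lTensor X)).subtype) ?_) e
  ext ⟨z, hz⟩
  constructor
  · rintro ⟨y, hy⟩
    exact ⟨y, congrArg Subtype.val hy⟩
  · rintro ⟨y, hy⟩
    exact ⟨y, Subtype.ext hy⟩

end tor
end S10

namespace S10
section supp
variable {R : Type} [CommRing R] [IsNoetherianRing R] [IsLocalRing R]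
open TensorProduct IsLocalRing
lemma supp_ker (N : Type) [AddCommGroup N] [Module R N]
    (hNfree : ∀ (p : Ideal R) (hp : p.IsPrime), p ≠ IsLocalRing.maximalIdeal R →
      Module.Free (Localization (@Ideal.primeCompl _ _ p hp))
        (LocalizedModule (@Ideal.primeCompl _ _ p hp) N))
    {Z P : Type} [AddCommGroup Z] [Module R Z] [AddCommGroup P] [Module R P]
    (i : Z →ₗ[R] P) (hi : Function.Injective i) :
    Module.support R (LinearMap.ker (i.rTensor N)) ⊆ PrimeSpectrum.zeroLocus (maximalIdeal R) := by
  intro p hp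
  by_contra hpm
  have hne : p.asIdeal ≠ maximalIdeal R := by
    intro h
    apply hpm
    rw [PrimeSpectrum.mem_zeroLocus, h]
  have := hNfree p.asIdeal p.2 hne
  refine (Module.notMem_support_iff'.2 ?_) hp
  rintro ⟨t, ht⟩
  let S := p.asIdeal.primeCompl
  have hfl : Module.Flat R (LocalizedModule S N) := 
    Module.Flat.trans R (Localization S) (LocalizedModule S N)
  let l := LocalizedModule.mkLinearMap S N
  have hinj := Module.Flat.rTensor_preserves_injective_linearMap (M := LocalizedModule S N) i hi
  have h0 : l.lTensor Z t = 0 := by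
    apply hinj
    rw [← LinearMap.comp_apply, LinearMap.rTensor_comp_lTensor, ← LinearMap.lTensor_comp_rTensor,
      LinearMap.comp_apply, LinearMap.mem_ker.1 ht, map_zero, map_zero]
  have h1 : l.rTensor Z (TensorProduct.comm R Z N t) = 0 := by
    rw [← LinearMap.comm_comp_lTensor_comp_comm_eq]
    simp [h0]
  have : IsLocalizedModule S (l.rTensor Z) := IsLocalizedModule.rTensor (A := R) S l
  obtain ⟨s, hs⟩ := (IsLocalizedModule.eq_zero_iff S (l.rTensor Z)).1 h1
  refine ⟨s.1, s.2, Subtype.ext ((TensorProduct.comm R Z N).injective ?_)⟩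
  rw [ZeroMemClass.coe_zero, map_zero]
  exact (LinearEquiv.map_smul _ _ _).trans hs

end supp
end S10

namespace S10
section main
variable {R : Type} [CommRing R]
variable {A B C W : Type} [AddCommGroup A] [Module R A] [AddCommGroup B] [Module R B]
  [AddCommGroup C] [Module R C] [AddCommGroup W] [Module R W]
open TensorProduct IsLocalRing

lemma pre_comp (f : A →ₗ[R] B) (g : B →ₗ[R] C) (n : ℕ) (x : E R C W n) :
    pre (g ∘ₗ f) W n x = pre f W n (pre g W n x) := by
  change (Abelian.Ext.mk₀ (ModuleCat.ofHom (g ∘ₗ f))).comp x (zero_add n) =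
    (Abelian.Ext.mk₀ (ModuleCat.ofHom f)).comp
      ((Abelian.Ext.mk₀ (ModuleCat.ofHom g)).comp x (zero_add n)) (zero_add n)
  rw [ModuleCat.ofHom_comp, ← Abelian.Ext.mk₀_comp_mk₀_assoc]

/-- The cokernel form of the connecting map. -/
lemma coker_iso {f : A →ₗ[R] B} {g : B →ₗ[R] C} (n : ℕ)
    (h : Function.Exact f g) (hf : Function.Injective f) (hg : Function.Surjective g)
    (hB : Subsingleton (E R B W (n+1))) :
    Nonempty (E R C W (n+1) ≃ₗ[R] (E R A W n ⧸ LinearMap.range (pre f W n))) := by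
  obtain ⟨δ, h1, h2, h3⟩ := les W n h hf hg
  have hs : Function.Surjective δ := fun y => (h3 y).1 (Subsingleton.elim _ _)
  exact ⟨((Submodule.quotEquivOfEq _ _ h2.linearMap_ker_eq.symm).trans
    (δ.quotKerEquivOfSurjective hs)).symm⟩

/-- degree zero. -/
def e0 (A W : Type) [AddCommGroup A] [Module R A] [AddCommGroup W] [Module R W] :
    E R A W 0 ≃ₗ[R] (A →ₗ[R] W) :=
  Abelian.Ext.linearEquiv₀.trans ModuleCat.homLinearEquiv

lemma e0_pre (f : A →ₗ[R] B) (x : E R B W 0) : e0 A W (pre f W 0 x) = (e0 B W x) ∘ₗ f := by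
  obtain ⟨y, rfl⟩ := (e0 B W).symm.surjective x
  rw [LinearEquiv.apply_symm_apply, ← LinearEquiv.eq_symm_apply]
  change (Abelian.Ext.mk₀ (ModuleCat.ofHom f)).comp (Abelian.Ext.mk₀ (ModuleCat.ofHom y)) (zero_add 0) =
    Abelian.Ext.mk₀ (ModuleCat.ofHom (y ∘ₗ f))
  rw [Abelian.Ext.mk₀_comp_mk₀, ModuleCat.ofHom_comp]

lemma pow_ext (N : Type) [AddCommGroup N] [Module R N] (k : ℕ) (h : Subsingleton (E R N W k)) (m : ℕ) :
    Subsingleton (E R (Fin m → N) W k) := by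
  induction m with
  | zero => exact sub_of_sub k inferInstance
  | succ m ih =>
    refine sub_mid (f := LinearMap.single R (fun _ : Fin (m+1) => N) 0)
      (g := LinearMap.funLeft R N (Fin.succ : Fin m → Fin (m+1))) k ?_ ?_ ?_ h ih
    · intro x
      constructor
      · intro hx
        refine ⟨x 0, ?_⟩
        ext j
        refine Fin.cases ?_ (fun j => ?_) j
        · simp
        · have := congrFun hx j
          simp [LinearMap.funLeft_apply] at this
          simp [this]
      · rintro ⟨y, rfl⟩
        ext j
        simp [LinearMap.funLeft_apply]
    · exact Pi.single_injective (M := fun _ : Fin (m+1) => N) 0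
    · exact LinearMap.funLeft_surjective_of_injective _ _ _ (Fin.succ_injective m)

variable (N : Type) [AddCommGroup N] [Module R N]

lemma free_ext (k : ℕ) (h : Subsingleton (E R N W k)) (m : ℕ) :
    Subsingleton (E R ((Fin m → R) ⊗[R] N) W k) :=
  sub_equiv k ((TensorProduct.comm R (Fin m → R) N).trans
    (TensorProduct.piScalarRight R R N (Fin m))) (pow_ext N k h m)

lemma free_ext' (k m : ℕ) : Subsingleton (E R (Fin m → R) W (k+1)) := by
  have : Projective (ModuleCat.of R (Fin m → R)) := inferInstance
  exact Abelian.Ext.subsingleton_of_projective _ _ _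

/-- adjunction in degree zero. -/
def adj0 (Z : Type) [AddCommGroup Z] [Module R Z] :
    E R (Z ⊗[R] N) R 0 ≃ₗ[R] E R Z (N →ₗ[R] R) 0 :=
  ((e0 (Z ⊗[R] N) R).trans (TensorProduct.lift.equiv (.id R) Z N R).symm).trans (e0 Z (N →ₗ[R] R)).symm

lemma adj0_pre {Z P : Type} [AddCommGroup Z] [Module R Z] [AddCommGroup P] [Module R P]
    (i : Z →ₗ[R] P) (x : E R (P ⊗[R] N) R 0) :
    adj0 N Z (pre (i.rTensor N) R 0 x) = pre i _ 0 (adj0 N P x) := by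
  apply (e0 Z (N →ₗ[R] R)).injective
  rw [e0_pre]
  simp only [adj0, LinearEquiv.trans_apply, LinearEquiv.apply_symm_apply, e0_pre]
  ext z n
  simp

lemma cok_iso (hN : ∀ k, 0 < k → Subsingleton (E R N R k)) {Z : Type} [AddCommGroup Z] [Module R Z]
    {m : ℕ} (i : Z →ₗ[R] (Fin m → R)) (n : ℕ)
    (h : Nonempty (E R (Z ⊗[R] N) R n ≃ₗ[R] E R Z (N →ₗ[R] R) n)) :
    Nonempty ((E R (Z ⊗[R] N) R n ⧸ LinearMap.range (pre (i.rTensor N) R n)) ≃ₗ[R]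
      (E R Z (N →ₗ[R] R) n ⧸ LinearMap.range (pre i (N →ₗ[R] R) n))) := by
  cases n with
  | zero =>
    refine ⟨Submodule.Quotient.equiv _ _ (adj0 N Z) ?_⟩
    ext y
    constructor
    · rintro ⟨_, ⟨x, rfl⟩, rfl⟩
      exact ⟨adj0 N _ x, (adj0_pre N i x).symm⟩
    · rintro ⟨x, rfl⟩
      refine ⟨_, ⟨(adj0 N _).symm x, rfl⟩, ?_⟩
      refine (adj0_pre N i _).trans ?_
      rw [LinearEquiv.apply_symm_apply]
  | succ n =>
    obtain ⟨e⟩ := h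
    have h1 := free_ext (W := R) N (n+1) (hN _ (by omega)) m
    have h2 := free_ext' (R := R) (W := N →ₗ[R] R) n m
    have r1 : LinearMap.range (pre (i.rTensor N) R (n+1)) = ⊥ := by
      rw [LinearMap.range_eq_bot]; exact LinearMap.ext fun x => by
        rw [Subsingleton.elim x 0, map_zero, map_zero]
    have r2 : LinearMap.range (pre i (N →ₗ[R] R) (n+1)) = ⊥ := by
      rw [LinearMap.range_eq_bot]; exact LinearMap.ext fun x => by
        rw [Subsingleton.elim x 0, map_zero, map_zero]
    exact ⟨(Submodule.quotEquivOfEqBot _ r1).trans (e.trans (Submodule.quotEquivOfEqBot _ r2).symm)⟩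

lemma pre_bij {f : A →ₗ[R] B} {g : B →ₗ[R] C} (n : ℕ)
    (h : Function.Exact f g) (hf : Function.Injective f) (hg : Function.Surjective g)
    (hA : ∀ k ≤ n, Subsingleton (E R A W k)) : Function.Bijective (pre g W n) := by
  have hAn := hA n le_rfl
  constructor
  · cases n with
    | zero => exact pre_inj0 hg
    | succ n =>
      obtain ⟨δ, h1, h2, h3⟩ := les W n h hf hg
      have := hA n (by omega)
      rw [← LinearMap.ker_eq_bot, LinearMap.ker_eq_bot']
      intro x hx
      obtain ⟨y, rfl⟩ := (h3 x).1 hx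
      rw [Subsingleton.elim y 0, map_zero]
  · obtain ⟨δ, h1, h2, h3⟩ := les W n h hf hg
    intro y
    exact (h1 y).1 (Subsingleton.elim _ _)

variable [IsNoetherianRing R] [IsLocalRing R]

lemma ker_range_exact (j : A →ₗ[R] B) : Function.Exact (LinearMap.ker j).subtype j.rangeRestrict := by
  intro x
  rw [Submodule.coe_subtype, Subtype.range_coe]
  exact (Subtype.ext_iff).trans Iff.rfl

lemma pre_bij_range (j : A →ₗ[R] B) (n : ℕ) (hA : ∀ k ≤ n, Subsingleton (E R (LinearMap.ker j) W k)) :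
    Function.Bijective (pre j.rangeRestrict W n) :=
  pre_bij n (ker_range_exact j) (Submodule.injective_subtype _) j.surjective_rangeRestrict hA

lemma les_range (j : A →ₗ[R] B) (W : Type) [AddCommGroup W] [Module R W] (n : ℕ) :
    ∃ δ : E R (LinearMap.ker j) W n →ₗ[R] E R (LinearMap.range j) W (n+1),
      Function.Exact (pre j.rangeRestrict W n) (pre (LinearMap.ker j).subtype W n) ∧
      Function.Exact (pre (LinearMap.ker j).subtype W n) δ ∧
      Function.Exact δ (pre j.rangeRestrict W (n+1)) :=
  les W n (ker_range_exact j) (Submodule.injective_subtype _) j.surjective_rangeRestrict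

lemma ker_finite [Module.Finite R A] (j : A →ₗ[R] B) : Module.Finite R (LinearMap.ker j) :=
  have : IsNoetherian R A := isNoetherian_of_isNoetherianRing_of_finite R A
  Module.Finite.of_fg (IsNoetherian.noetherian _)

lemma range_exact {j : A →ₗ[R] B} {g : B →ₗ[R] C} (h : Function.Exact j g) :
    Function.Exact (LinearMap.range j).subtype g := by
  intro x
  rw [Submodule.coe_subtype, Subtype.range_coe]
  exact h x

lemma pre_factor (j : A →ₗ[R] B) (n : ℕ) (x : E R B W n) :
    pre j W n x = pre j.rangeRestrict W n (pre (LinearMap.range j).subtype W n x) := by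
  rw [← pre_comp]; rfl

lemma abs1 (j : A →ₗ[R] B) (g : B →ₗ[R] C) (h : Function.Exact j g) (hg : Function.Surjective g)
    (n : ℕ) (hB : Subsingleton (E R B W (n+1)))
    (hT : ∀ k ≤ n, Subsingleton (E R (LinearMap.ker j) W k)) :
    Nonempty (E R C W (n+1) ≃ₗ[R] (E R A W n ⧸ LinearMap.range (pre j W n))) := by
  have hb := pre_bij_range j n hT
  obtain ⟨e1⟩ := coker_iso (W := W) n (range_exact h) (Submodule.injective_subtype _) hg hB
  refine ⟨e1.trans (Submodule.Quotient.equiv _ _ (LinearEquiv.ofBijective _ hb) ?_)⟩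
  ext y
  constructor
  · rintro ⟨_, ⟨x, rfl⟩, rfl⟩
    exact ⟨x, pre_factor j n x⟩
  · rintro ⟨x, rfl⟩
    exact ⟨_, ⟨x, rfl⟩, (pre_factor j n x).symm⟩

lemma abs2 (j : A →ₗ[R] B) (g : B →ₗ[R] C) (h : Function.Exact j g) (hg : Function.Surjective g)
    (n : ℕ) (hC : Subsingleton (E R C W (n+1)))
    (hr : Subsingleton (E R (LinearMap.range j) W (n+1))) :
    Nonempty (E R (LinearMap.ker j) W n ≃ₗ[R] (E R A W n ⧸ LinearMap.range (pre j W n))) := by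
  obtain ⟨δ, h1, h2, h3⟩ := les W n (range_exact h) (Submodule.injective_subtype _) hg
  obtain ⟨δ', h1', h2', h3'⟩ := les_range j W n
  have s1 : Function.Surjective (pre (LinearMap.range j).subtype W n) := fun y => 
    (h2 y).1 (Subsingleton.elim _ _)
  have s2 : Function.Surjective (pre (LinearMap.ker j).subtype W n) := fun y =>
    (h2' y).1 (Subsingleton.elim _ _)
  have hk : LinearMap.range (pre j W n) = LinearMap.ker (pre (LinearMap.ker j).subtype W n) := by
    rw [h1'.linearMap_ker_eq]
    ext y
    constructor
    · rintro ⟨x, rfl⟩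
      exact ⟨_, (pre_factor j n x).symm⟩
    · rintro ⟨x, rfl⟩
      obtain ⟨z, rfl⟩ := s1 x
      exact ⟨z, pre_factor j n z⟩
  exact ⟨((Submodule.quotEquivOfEq _ _ hk).trans (LinearMap.quotKerEquivOfSurjective _ s2)).symm⟩

lemma ext_ker (d : ℕ) (hdim : ringKrullDim R = d)
    (hG : ∀ (L : Type) [AddCommGroup L] [Module R L] [Module.Finite R L],
      ∀ i, d < i → Subsingleton (E R L R i)) [Module.Finite R A] (j : A →ₗ[R] B)
    (hT : Module.support R (LinearMap.ker j) ⊆ PrimeSpectrum.zeroLocus (maximalIdeal R)) (k : ℕ)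
    (hk : k < d) : Subsingleton (E R (LinearMap.ker j) R k) :=
  have := ker_finite j
  ext_support d hdim hG _ hT k hk

lemma ext_range (d : ℕ)
    (hG : ∀ (L : Type) [AddCommGroup L] [Module R L] [Module.Finite R L],
      ∀ i, d < i → Subsingleton (E R L R i)) [Module.Finite R A] (j : A →ₗ[R] B) :
    Subsingleton (E R (LinearMap.range j) R (d+1)) :=
  hG _ _ (by omega)

theorem step (hN : ∀ k, 0 < k → Subsingleton (E R N R k)) 
    {Z Y : Type} [AddCommGroup Z] [Module R Z] [AddCommGroup Y] [Module R Y]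
    {m : ℕ} (i : Z →ₗ[R] (Fin m → R)) (q : (Fin m → R) →ₗ[R] Y) (hiq : Function.Exact i q)
    (hi : Function.Injective i) (hq : Function.Surjective q) (n : ℕ)
    (hT : ∀ k ≤ n, Subsingleton (E R (LinearMap.ker (i.rTensor N)) R k))
    (h : Nonempty (E R (Z ⊗[R] N) R n ≃ₗ[R] E R Z (N →ₗ[R] R) n)) :
    Nonempty (E R (Y ⊗[R] N) R (n+1) ≃ₗ[R] E R Y (N →ₗ[R] R) (n+1)) := by
  obtain ⟨e1⟩ := abs1 (W := R) (i.rTensor N) (q.rTensor N) (rTensor_exact N hiq hq)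
    (LinearMap.rTensor_surjective N hq) n (free_ext (W := R) N (n+1) (hN _ (by omega)) m) hT
  obtain ⟨e2⟩ := coker_iso (W := (N →ₗ[R] R)) n hiq hi hq (free_ext' n m)
  obtain ⟨e3⟩ := cok_iso N hN i n h
  exact ⟨e1.trans (e3.trans e2.symm)⟩

theorem claim (d : ℕ) (hdim : ringKrullDim R = d)
    (hG : ∀ (L : Type) [AddCommGroup L] [Module R L] [Module.Finite R L],
      ∀ i, d < i → Subsingleton (E R L R i)) [Module.Finite R N]
    (hN : ∀ k, 0 < k → Subsingleton (E R N R k))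
    (hNfree : ∀ (p : Ideal R) (hp : p.IsPrime), p ≠ IsLocalRing.maximalIdeal R →
      Module.Free (Localization (@Ideal.primeCompl _ _ p hp))
        (LocalizedModule (@Ideal.primeCompl _ _ p hp) N)) (n : ℕ) (hn : n ≤ d)
    (Y : Type) [AddCommGroup Y] [Module R Y] [Module.Finite R Y] :
    Nonempty (E R (Y ⊗[R] N) R n ≃ₗ[R] E R Y (N →ₗ[R] R) n) := by
  induction n generalizing Y with
  | zero => exact ⟨adj0 N Y⟩
  | succ n ih =>
    obtain ⟨m, q, hq⟩ := Module.Finite.exists_fin' R Y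
    refine step N hN (LinearMap.ker q).subtype q (LinearMap.exact_subtype_ker_map q)
      (Submodule.injective_subtype _) hq n ?_ (ih (by omega) _)
    intro k hk
    exact ext_ker d hdim hG _ (supp_ker N hNfree _ (Submodule.injective_subtype _)) k (by omega)

theorem final (d : ℕ) (hdim : ringKrullDim R = d)
    (hG : ∀ (L : Type) [AddCommGroup L] [Module R L] [Module.Finite R L],
      ∀ i, d < i → Subsingleton (E R L R i)) [Module.Finite R N]
    (hN : ∀ k, 0 < k → Subsingleton (E R N R k))
    (hNfree : ∀ (p : Ideal R) (hp : p.IsPrime), p ≠ IsLocalRing.maximalIdeal R →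
      Module.Free (Localization (@Ideal.primeCompl _ _ p hp))
        (LocalizedModule (@Ideal.primeCompl _ _ p hp) N))
    {Y X : Type} [AddCommGroup Y] [Module R Y] [AddCommGroup X] [Module R X]
    [Module.Finite R Y] [Module.Finite R X]
    {m : ℕ} (i : Y →ₗ[R] (Fin m → R)) (q : (Fin m → R) →ₗ[R] X) (hiq : Function.Exact i q)
    (hi : Function.Injective i) (hq : Function.Surjective q) :
    Nonempty (E R (LinearMap.ker (i.rTensor N)) R d ≃ₗ[R] E R X (N →ₗ[R] R) (d+1)) := by
  obtain ⟨e1⟩ := abs2 (W := R) (i.rTensor N) (q.rTensor N) (rTensor_exact N hiq hq)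
    (LinearMap.rTensor_surjective N hq) d (hG (X ⊗[R] N) (d+1) (by omega)) (ext_range d hG _)
  obtain ⟨e2⟩ := coker_iso (W := (N →ₗ[R] R)) d hiq hi hq (free_ext' d m)
  obtain ⟨e3⟩ := cok_iso N hN i d (claim N d hdim hG hN hNfree d le_rfl Y)
  exact ⟨e1.trans (e3.trans e2.symm)⟩

end main
end S10

namespace S10
lemma ext_congr {R : Type} [CommRing R] {A B W : Type} [AddCommGroup A] [Module R A] [AddCommGroup B]
    [Module R B] [AddCommGroup W] [Module R W] (e : A ≃ₗ[R] B) (n : ℕ) :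
    Nonempty (E R B W n ≃ₗ[R] E R A W n) := by
  have : Function.Exact (0 : PUnit →ₗ[R] A) e.toLinearMap := by
    intro x; simp [eq_comm (a := (0:A))]
  exact ⟨LinearEquiv.ofBijective _ (pre_bij (A := PUnit) (f := 0) (g := e.toLinearMap) n this
    (fun _ _ _ => rfl) e.surjective (fun k _ => sub_of_sub k inferInstance))⟩

lemma ext_T {R : Type} [CommRing R] (T : ModuleCat.{0} R) {K W : Type} [AddCommGroup K] [Module R K]
    [AddCommGroup W] [Module R W] (e : T ≃ₗ[R] K) (n : ℕ) :
    Nonempty ((((Ext R (ModuleCat R) n).obj (Opposite.op T)).obj (ModuleCat.of R W)) ≃ₗ[R]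
      E R K W n) := by
  obtain ⟨b⟩ := bridge (ModuleCat.of R K) (ModuleCat.of R W) n
  exact ⟨(((((Ext R (ModuleCat R) n).mapIso e.toModuleIso.op).app
    (ModuleCat.of R W)).toLinearEquiv).symm).trans b⟩

lemma sub_E {R : Type} [CommRing R] {K W : Type} [AddCommGroup K] [Module R K]
    [AddCommGroup W] [Module R W] (n : ℕ)
    (h : Subsingleton (((Ext R (ModuleCat R) n).obj (Opposite.op (ModuleCat.of R K))).obj
      (ModuleCat.of R W))) : Subsingleton (E R K W n) :=
  (bridge (ModuleCat.of R K) (ModuleCat.of R W) n).some.symm.injective.subsingleton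

theorem fin1 (R : Type) [CommRing R] [IsNoetherianRing R] [IsLocalRing R] (d : ℕ)
    (hdim : ringKrullDim R = d)
    (hGor : ∀ (L : ModuleCat R), Module.Finite R L → ∀ i : ℕ, d < i →
      Subsingleton (((Ext R (ModuleCat R) i).obj (Opposite.op L)).obj (ModuleCat.of R R)))
    (N : Type) [AddCommGroup N] [Module R N] [Module.Finite R N]
    (hNext : ∀ i : ℕ, 0 < i →
      Subsingleton (((Ext R (ModuleCat R) i).obj (Opposite.op (ModuleCat.of R N))).obj
        (ModuleCat.of R R)))
    (hNfree : ∀ (p : Ideal R) (hp : p.IsPrime), p ≠ IsLocalRing.maximalIdeal R →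
      Module.Free (Localization (@Ideal.primeCompl _ _ p hp))
        (LocalizedModule (@Ideal.primeCompl _ _ p hp) N))
    {Y X : Type} [AddCommGroup Y] [Module R Y] [AddCommGroup X] [Module R X]
    [Module.Finite R Y] [Module.Finite R X]
    {m : ℕ} (i : Y →ₗ[R] (Fin m → R)) (q : (Fin m → R) →ₗ[R] X) (hiq : Function.Exact i q)
    (hi : Function.Injective i) (hq : Function.Surjective q) :
    Nonempty ((((Ext R (ModuleCat R) d).obj (Opposite.op
      (((Tor (ModuleCat R) 1).obj (ModuleCat.of R X)).obj (ModuleCat.of R N)))).obj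
        (ModuleCat.of R R)) ≃ₗ[R]
      (((Ext R (ModuleCat R) (d + 1)).obj (Opposite.op (ModuleCat.of R X))).obj
        (ModuleCat.of R (N →ₗ[R] R)))) := by
  obtain ⟨e1⟩ := tor_iso (N := N) i q hiq hi hq
  obtain ⟨e2⟩ := final N d hdim (fun L _ _ _ i hi => sub_E i (hGor (ModuleCat.of R L) ‹_› i hi))
    (fun k hk => sub_E k (hNext k hk)) hNfree i q hiq hi hq
  obtain ⟨e3⟩ := ext_T (W := R) _ e1 d
  obtain ⟨b2⟩ := ext_T (W := N →ₗ[R] R) (ModuleCat.of R X) (LinearEquiv.refl R X) (d+1)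
  exact ⟨e3.trans (e2.trans b2.symm)⟩
end S10

/-- isomorphism (2.4) in the proof of Theorem 2.2: let `R` be a
commutative Noetherian local Gorenstein ring of Krull dimension `d` (Gorenstein expressed
as: `Ext^i_R(L, R) = 0` for every finitely generated `L` and every `i > d`).  Let `M` be
finitely generated with transpose `Tr M` coming from a finite free presentation, and let
`N` be finitely generated with `Ext^i_R(N,R) = 0` for `i > 0` and `N_p` free over `R_p`
for every non-maximal prime `p`.  Then
`Ext^d_R(Tor₁^R(Tr M, N), R) ≅ Ext^{d+1}_R(Tr M, Hom_R(N, R))`. -/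
theorem stmt_10 (R : Type) [CommRing R] [IsNoetherianRing R] [IsLocalRing R] (d : ℕ)
    (hdim : ringKrullDim R = d)
    (hGor : ∀ (L : ModuleCat R), Module.Finite R L → ∀ i : ℕ, d < i →
      Subsingleton (((Ext R (ModuleCat R) i).obj (Opposite.op L)).obj (ModuleCat.of R R)))
    (M N : Type) [AddCommGroup M] [AddCommGroup N] [Module R M] [Module R N]
    [Module.Finite R M] [Module.Finite R N]
    (n0 n1 : ℕ) (f : (Fin n1 → R) →ₗ[R] (Fin n0 → R)) (g : (Fin n0 → R) →ₗ[R] M)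
    (hg : Function.Surjective g) (hfg : Function.Exact f g)
    (hNext : ∀ i : ℕ, 0 < i →
      Subsingleton (((Ext R (ModuleCat R) i).obj (Opposite.op (ModuleCat.of R N))).obj
        (ModuleCat.of R R)))
    (hNfree : ∀ (p : Ideal R) (hp : p.IsPrime), p ≠ IsLocalRing.maximalIdeal R →
      Module.Free (Localization (@Ideal.primeCompl _ _ p hp))
        (LocalizedModule (@Ideal.primeCompl _ _ p hp) N)) :
    Nonempty (
      (((Ext R (ModuleCat R) d).obj
          (Opposite.op
            (((Tor (ModuleCat R) 1).obj
                (ModuleCat.of R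
                  (Module.Dual R (Fin n1 → R) ⧸ LinearMap.range f.dualMap))).obj
              (ModuleCat.of R N)))).obj
        (ModuleCat.of R R)) ≃ₗ[R]
      (((Ext R (ModuleCat R) (d + 1)).obj
          (Opposite.op
            (ModuleCat.of R
              (Module.Dual R (Fin n1 → R) ⧸ LinearMap.range f.dualMap)))).obj
        (ModuleCat.of R (N →ₗ[R] R)))) := by
  obtain ⟨m, q, hq⟩ := Module.Finite.exists_fin' R
    (Module.Dual R (Fin n1 → R) ⧸ LinearMap.range f.dualMap)
  exact S10.fin1 R d hdim hGor N hNext hNfree (LinearMap.ker q).subtype q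
    (LinearMap.exact_subtype_ker_map q) (Submodule.injective_subtype (LinearMap.ker q)) hq
end
end
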